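/- arXiv:2112.07333 — 3 statements merged into one kernel-verified Lean document; each statement's English description precedes it below -/
import Mathlib

section
/- Let S be a numerical semigroup and let m be a nonzero element of S. Then for every real number q, (q − 1) · ∑_{k ∈ Ap_m(S)} q^k = (q^m − 1) · ( (q − 1) · ∑_{k ∈ ℕ \ S} q^k + 1 ). -/
/-- A numerical semigroup: an additive submonoid of ℕ whose complement in ℕ is finite. -/
def IsNumericalSemigroup (S : Set ℕ) : Prop :=
  0 ∈ S ∧ (∀ x ∈ S, ∀ y ∈ S, x + y ∈ S) ∧ Sᶜ.Finite

/-- The Apéry set of `m` in `S`: elements `s ∈ S` such that `s - m ∉ S`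
(as integers, i.e. either `s < m` or the natural number `s - m` is not in `S`). -/
def apery (S : Set ℕ) (m : ℕ) : Set ℕ :=
  {s ∈ S | ¬ (m ≤ s ∧ s - m ∈ S)}

theorem apery_union_compl {S : Set ℕ} (hS : IsNumericalSemigroup S) {m : ℕ} (hm : m ∈ S) :
    apery S m ∪ Sᶜ = Set.Iio m ∪ (· + m) '' Sᶜ := by
  have closed : ∀ x ∈ S, x + m ∈ S := fun x hx => hS.2.1 x hx m hm
  ext k
  simp only [apery, Set.mem_union, Set.mem_ofPred_eq, Set.mem_compl_iff, Set.mem_Iio, Set.mem_image]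
  rcases lt_or_ge k m with hk | hk
  · simp only [hk, not_le.mpr hk, false_and, not_false_eq_true, and_true, true_or, iff_true]
    exact em _
  · obtain ⟨j, rfl⟩ := Nat.exists_eq_add_of_le' hk
    have := closed j
    simp only [hk, not_lt.mpr hk, Nat.add_sub_cancel, true_and, false_or, Nat.add_right_cancel_iff,
      exists_eq_right]
    tauto

theorem finite_apery {S : Set ℕ} (hS : IsNumericalSemigroup S) {m : ℕ} (hm : m ∈ S) :
    (apery S m).Finite :=
  ((Set.finite_Iio m).union (hS.2.2.image _)).subset
    (apery_union_compl hS hm ▸ Set.subset_union_left)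

theorem finsum_apery_add_finsum_compl {S : Set ℕ} (hS : IsNumericalSemigroup S) {m : ℕ}
    (hm : m ∈ S) (q : ℝ) :
    ∑ᶠ k ∈ apery S m, q ^ k + ∑ᶠ k ∈ Sᶜ, q ^ k
      = ∑ k ∈ Finset.range m, q ^ k + q ^ m * ∑ᶠ k ∈ Sᶜ, q ^ k := by
  have hdisj : Disjoint (apery S m) Sᶜ :=
    Set.disjoint_compl_right_iff_subset.mpr (Set.sep_subset _ _)
  have hdisj' : Disjoint (Set.Iio m) ((· + m) '' Sᶜ) := by
    rw [Set.disjoint_left]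
    rintro _ hk ⟨j, -, rfl⟩
    exact absurd hk (by simp)
  rw [← finsum_mem_union hdisj (finite_apery hS hm) hS.2.2, apery_union_compl hS hm,
    finsum_mem_union hdisj' (Set.finite_Iio m) (hS.2.2.image _),
    finsum_mem_image (add_left_injective m).injOn, mul_finsum_mem]
  congr 1
  · rw [← finsum_mem_coe_finset, Finset.coe_range]
  · simp only [pow_add, mul_comm]

theorem stmt_1 (S : Set ℕ) (hS : IsNumericalSemigroup S)
    (m : ℕ) (hm : m ∈ S) (hm0 : m ≠ 0) (q : ℝ) :
    (q - 1) * ∑ᶠ k ∈ apery S m, q ^ k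
      = (q ^ m - 1) * ((q - 1) * (∑ᶠ k ∈ Sᶜ, q ^ k) + 1) := by
  linear_combination (q - 1) * finsum_apery_add_finsum_compl hS hm q + mul_geom_sum q m
end

section
/- Let a, b be coprime positive integers, f : ℝ → ℝ a 1-periodic function (f(x+1) = f(x) for all x), and α_a, β_a, α_b, β_b real numbers such that f(i·a/b) = α_a · ∑_{j=0}^{a−1} f(i/b + j/a) + β_a for every i ∈ {0, …, b−1}, and f(j·b/a) = α_b · ∑_{i=0}^{b−1} f(i/b + j/a) + β_b for every j ∈ {0, …, a−1}. Then α_b · ∑_{i=0}^{b−1} (i/b) f(i·a/b) + α_a · ∑_{j=0}^{a−1} (j/a) f(j·b/a) = α_a α_b · ∑_{k ∈ C_{a,b}} f(k/(ab)) + α_a α_b · ∑_{k=0}^{ab−1} (k/(ab)) f(k/(ab)) + α_b β_a (b−1)/2 + α_a β_b (a−1)/2. -/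
/-- The numerical semigroup generated by `a` and `b`. -/
def numSgp (a b : ℕ) : Set ℕ := {n | ∃ i j : ℕ, n = i * a + j * b}

/-- The set of gaps of the numerical semigroup generated by `a` and `b`. -/
def gaps (a b : ℕ) : Set ℕ := (numSgp a b)ᶜ

theorem modEq_of_comb_modEq {a b i j i' j' : ℕ} (hab : Nat.Coprime a b)
    (h : i * a + j * b ≡ i' * a + j' * b [MOD b]) : i ≡ i' [MOD b] := by
  have h' : i * a ≡ i' * a [MOD b] := by
    simpa [Nat.ModEq, Nat.add_mul_mod_self_right] using h
  exact Nat.ModEq.cancel_right_of_coprime (by simpa [Nat.Coprime, Nat.gcd_comm] using hab) h'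

theorem comb_modEq_iff {a b i j i' j' : ℕ} (hab : Nat.Coprime a b)
    (h : i * a + j * b ≡ i' * a + j' * b [MOD a * b]) : i ≡ i' [MOD b] ∧ j ≡ j' [MOD a] := by
  refine ⟨modEq_of_comb_modEq hab (h.of_mul_left a), modEq_of_comb_modEq hab.symm (i := j) (i' := j') (j := i) (j' := i') ?_⟩
  rw [add_comm (j * b), add_comm (j' * b)]
  exact h.of_mul_right b

theorem le_of_modEq_of_lt {m i i' : ℕ} (h : i ≡ i' [MOD m]) (hi : i < m) : i ≤ i' := by
  have h' : i % m = i' % m := h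
  rw [Nat.mod_eq_of_lt hi] at h'
  exact h' ▸ Nat.mod_le i' m

theorem comb_lt_two_mul {a b i j : ℕ} (hi : i < b) (hj : j < a) :
    i * a + j * b < 2 * (a * b) := by
  nlinarith [Nat.mul_lt_mul_of_pos_right hi (show 0 < a by omega),
    Nat.mul_lt_mul_of_pos_right hj (show 0 < b by omega)]

theorem injOn_comb_mod {a b : ℕ} (hab : Nat.Coprime a b) :
    Set.InjOn (fun p : ℕ × ℕ => (p.1 * a + p.2 * b) % (a * b))
      (Finset.range b ×ˢ Finset.range a : Finset (ℕ × ℕ)) := by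
  rintro ⟨i, j⟩ hp ⟨i', j'⟩ hq h
  simp only [Finset.coe_product, Set.mem_prod, Finset.mem_coe, Finset.mem_range] at hp hq
  obtain ⟨h1, h2⟩ := comb_modEq_iff hab h
  exact Prod.ext (h1.eq_of_lt_of_lt hp.1 hq.1) (h2.eq_of_lt_of_lt hp.2 hq.2)

theorem image_comb_mod {a b : ℕ} (ha : 0 < a) (hb : 0 < b) (hab : Nat.Coprime a b) :
    (Finset.range b ×ˢ Finset.range a).image
      (fun p : ℕ × ℕ => (p.1 * a + p.2 * b) % (a * b)) = Finset.range (a * b) := by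
  apply Finset.eq_of_subset_of_card_le
  · intro k hk
    obtain ⟨p, -, rfl⟩ := Finset.mem_image.1 hk
    exact Finset.mem_range.2 (Nat.mod_lt _ (Nat.mul_pos ha hb))
  · rw [Finset.card_image_of_injOn (injOn_comb_mod hab)]
    simp [mul_comm]

/-- Reducing `i * a + j * b` modulo `a * b` yields a gap exactly when the reduction is nontrivial. -/
theorem comb_mod_mem_gaps_iff {a b i j : ℕ} (hab : Nat.Coprime a b) (hi : i < b) (hj : j < a) :
    (i * a + j * b) % (a * b) ∈ gaps a b ↔ a * b ≤ i * a + j * b := by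
  constructor
  · intro h
    by_contra! hlt
    rw [Nat.mod_eq_of_lt hlt] at h
    exact h ⟨i, j, rfl⟩
  · rintro hle ⟨i', j', h⟩
    have hmod : i * a + j * b ≡ i' * a + j' * b [MOD a * b] := by
      rw [← h]; exact (Nat.mod_modEq _ _).symm
    obtain ⟨h1, h2⟩ := comb_modEq_iff hab hmod
    have h3 := Nat.mul_le_mul_right a (le_of_modEq_of_lt h1 hi)
    have h4 := Nat.mul_le_mul_right b (le_of_modEq_of_lt h2 hj)
    have h5 : (i * a + j * b) % (a * b) < a * b :=
      Nat.mod_lt _ (Nat.mul_pos (by omega) (by omega))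
    omega

theorem lt_of_mem_gaps {a b k : ℕ} (ha : 0 < a) (hb : 0 < b) (hab : Nat.Coprime a b)
    (hk : k ∈ gaps a b) : k < a * b := by
  by_contra! hle
  have hmem : k % (a * b) ∈ Finset.range (a * b) :=
    Finset.mem_range.2 (Nat.mod_lt _ (Nat.mul_pos ha hb))
  rw [← image_comb_mod ha hb hab] at hmem
  obtain ⟨⟨i, j⟩, hp, h⟩ := Finset.mem_image.1 hmem
  simp only [Finset.mem_product, Finset.mem_range] at hp h
  have hlt := comb_lt_two_mul hp.1 hp.2
  have hn : i * a + j * b ≤ k := by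
    by_contra! hkn
    rw [Nat.mod_eq_sub_mod hle, Nat.mod_eq_sub_mod (hle.trans hkn.le),
      Nat.mod_eq_of_lt (by omega), Nat.mod_eq_of_lt (by omega)] at h
    omega
  obtain ⟨t, ht⟩ := (Nat.modEq_iff_dvd' hn).1 h
  refine hk ⟨i + t * b, j, ?_⟩
  have : k = i * a + j * b + a * b * t := by omega
  rw [this]; ring

theorem gaps_finsum_eq {a b : ℕ} (ha : 0 < a) (hb : 0 < b) (hab : Nat.Coprime a b)
    [DecidablePred (· ∈ gaps a b)] (g : ℕ → ℝ) :
    ∑ᶠ k ∈ gaps a b, g k = ∑ k ∈ Finset.range (a * b), if k ∈ gaps a b then g k else 0 := by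
  rw [← Finset.sum_filter]
  refine finsum_mem_eq_sum_of_inter_support_eq _ ?_
  ext k
  simp only [Set.mem_inter_iff, Finset.coe_filter, Finset.mem_range, Set.mem_ofPred_eq]
  exact ⟨fun h => ⟨⟨lt_of_mem_gaps ha hb hab h.1, h.1⟩, h.2⟩, fun h => ⟨h.1.2, h.2⟩⟩

theorem sum_comb_eq {a b : ℕ} (ha : 0 < a) (hb : 0 < b) (hab : Nat.Coprime a b)
    {f : ℝ → ℝ} (hper : ∀ x : ℝ, f (x + 1) = f x) :
    ∑ i ∈ Finset.range b, ∑ j ∈ Finset.range a, (i / b + j / a : ℝ) * f (i / b + j / a)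
      = (∑ᶠ k ∈ gaps a b, f (k / (a * b)))
        + ∑ k ∈ Finset.range (a * b), (k / (a * b) : ℝ) * f (k / (a * b)) := by
  classical
  have ha' : (a : ℝ) ≠ 0 := by positivity
  have hb' : (b : ℝ) ≠ 0 := by positivity
  rw [gaps_finsum_eq ha hb hab (fun k : ℕ => f (k / (a * b))), ← Finset.sum_add_distrib,
    ← image_comb_mod ha hb hab, Finset.sum_image (injOn_comb_mod hab), ← Finset.sum_product']
  refine Finset.sum_congr rfl ?_
  rintro ⟨i, j⟩ hp
  simp only [Finset.mem_product, Finset.mem_range] at hp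
  have hx : (i / b + j / a : ℝ) = ((i * a + j * b : ℕ) : ℝ) / (a * b) := by
    push_cast; field_simp
  have hlt := comb_lt_two_mul hp.1 hp.2
  simp only [comb_mod_mem_gaps_iff hab hp.1 hp.2, hx]
  split_ifs with hle
  · obtain ⟨k, hk⟩ := Nat.exists_eq_add_of_le hle
    rw [hk, Nat.add_mod_left, Nat.mod_eq_of_lt (by omega)]
    have hx' : ((a * b + k : ℕ) : ℝ) / (a * b) = k / (a * b) + 1 := by
      push_cast; field_simp; ring
    rw [hx', hper]; ring
  · rw [Nat.mod_eq_of_lt (not_le.1 hle), zero_add]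

theorem sum_range_div_self {n : ℕ} (hn : 0 < n) :
    ∑ i ∈ Finset.range n, (i / n : ℝ) = (n - 1) / 2 := by
  have hn' : (n : ℝ) ≠ 0 := by positivity
  have h : (∑ i ∈ Finset.range n, (i : ℝ)) * 2 = n * (n - 1) := by
    rw [← Nat.cast_pred hn]
    have := congrArg (Nat.cast (R := ℝ)) (Finset.sum_range_id_mul_two n)
    rwa [Nat.cast_mul, Nat.cast_mul, Nat.cast_sum] at this
  rw [← Finset.sum_div]
  field_simp
  linarith

theorem stmt_9 (a b : ℕ) (ha : 0 < a) (hb : 0 < b) (hab : Nat.Coprime a b)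
    (f : ℝ → ℝ) (hper : ∀ x : ℝ, f (x + 1) = f x) (αa βa αb βb : ℝ)
    (hfa : ∀ i ∈ Finset.range b,
      f (i * a / b) = αa * (∑ j ∈ Finset.range a, f (i / b + j / a)) + βa)
    (hfb : ∀ j ∈ Finset.range a,
      f (j * b / a) = αb * (∑ i ∈ Finset.range b, f (i / b + j / a)) + βb) :
    αb * (∑ i ∈ Finset.range b, (i / b : ℝ) * f (i * a / b))
      + αa * (∑ j ∈ Finset.range a, (j / a : ℝ) * f (j * b / a))
      = αa * αb * (∑ᶠ k ∈ gaps a b, f (k / (a * b)))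
        + αa * αb * (∑ k ∈ Finset.range (a * b), (k / (a * b) : ℝ) * f (k / (a * b)))
        + αb * βa * (b - 1) / 2 + αa * βb * (a - 1) / 2 := by
  have hA : ∑ i ∈ Finset.range b, (i / b : ℝ) * f (i * a / b)
      = αa * (∑ i ∈ Finset.range b, ∑ j ∈ Finset.range a, (i / b : ℝ) * f (i / b + j / a))
        + βa * ((b - 1) / 2) := by
    rw [← sum_range_div_self hb, Finset.mul_sum, Finset.mul_sum, ← Finset.sum_add_distrib]
    refine Finset.sum_congr rfl fun i hi => ?_
    rw [hfa i hi, ← Finset.mul_sum]; ring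
  have hB : ∑ j ∈ Finset.range a, (j / a : ℝ) * f (j * b / a)
      = αb * (∑ i ∈ Finset.range b, ∑ j ∈ Finset.range a, (j / a : ℝ) * f (i / b + j / a))
        + βb * ((a - 1) / 2) := by
    rw [← sum_range_div_self ha, Finset.sum_comm, Finset.mul_sum, Finset.mul_sum,
      ← Finset.sum_add_distrib]
    refine Finset.sum_congr rfl fun j hj => ?_
    rw [hfb j hj, ← Finset.mul_sum]; ring
  have hsum := sum_comb_eq ha hb hab hper
  simp only [add_mul, Finset.sum_add_distrib] at hsum
  rw [hA, hB]
  linear_combination αa * αb * hsum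
end

section
/- Let a, b be coprime positive integers, h : ℝ → ℝ a 1-periodic function (h(x+1) = h(x) for all x), and λ, μ real numbers. Then λ · ∑_{k=0}^{b−1} (k·a/b) h(k·a/b) + μ · ∑_{k=0}^{a−1} (k·b/a) h(k·b/a) = λ · ∑_{k=0}^{b−1} (k/b) h(k/b) + μ · ∑_{k=0}^{a−1} (k/a) h(k/a) + ∑_{k ∈ C_{a,b}} ( λ·h(k/b) + μ·h(k/a) ). -/
open Finset in
/-- Multiplication by `a` permutes the residues modulo `b`. -/
lemma injOn_mul_mod (a b : ℕ) (hab : Nat.Coprime a b) :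
    Set.InjOn (fun k => k * a % b) (range b : Set ℕ) := by
  intro i hi j hj hij
  simp only [coe_range, Set.mem_Iio] at hi hj
  have h1 : i ≡ j [MOD b] := Nat.ModEq.cancel_right_of_coprime hab.symm hij
  exact Nat.ModEq.eq_of_lt_of_lt h1 hi hj

open Finset in
lemma surjOn_mul_mod (a b : ℕ) (hb : 0 < b) (hab : Nat.Coprime a b) :
    Set.SurjOn (fun k => k * a % b) (range b : Set ℕ) (range b : Set ℕ) :=
  surjOn_of_injOn_of_card_le _ (fun k _ => by simpa using Nat.mod_lt _ hb)
    (injOn_mul_mod a b hab) le_rfl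

lemma numSgp_comm (a b : ℕ) : numSgp a b = numSgp b a := by
  ext n
  constructor <;> rintro ⟨i, j, rfl⟩ <;> exact ⟨j, i, add_comm _ _⟩

/-- A number is a gap iff it lies below the least multiple of `a` in its class modulo `b`. -/
lemma mem_gaps_iff (a b : ℕ) (hb : 0 < b) (hab : Nat.Coprime a b) (n : ℕ) :
    n ∈ gaps a b ↔ ∃ k < b, k * a % b = n % b ∧ n / b < k * a / b := by
  constructor
  · intro hn
    obtain ⟨k, hk, hkn⟩ := surjOn_mul_mod a b hb hab
      (show n % b ∈ (Finset.range b : Set ℕ) by simpa using Nat.mod_lt _ hb)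
    simp only [Finset.coe_range, Set.mem_Iio] at hk hkn
    refine ⟨k, hk, hkn, ?_⟩
    by_contra! hle
    refine hn ⟨k, n / b - k * a / b, ?_⟩
    obtain ⟨d, hd⟩ := Nat.exists_eq_add_of_le hle
    rw [hd, Nat.add_sub_cancel_left]
    calc n = n % b + b * (n / b) := (Nat.mod_add_div n b).symm
      _ = (k * a % b + b * (k * a / b)) + d * b := by rw [hd, hkn]; ring
      _ = k * a + d * b := by rw [Nat.mod_add_div]
  · rintro ⟨k, hk, hkn, hlt⟩ ⟨i, j, rfl⟩
    rw [Nat.add_mul_mod_self_right] at hkn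
    have hki : k ≡ i [MOD b] := Nat.ModEq.cancel_right_of_coprime hab.symm hkn
    have hle : k ≤ i := by
      rw [← Nat.mod_eq_of_lt hk, hki]
      exact Nat.mod_le i b
    refine absurd hlt (not_lt.mpr (Nat.div_le_div_right ?_))
    exact (Nat.mul_le_mul_right a hle).trans (Nat.le_add_right _ _)

open Finset in
/-- The gaps are the numbers `k * a % b + q * b` with `k < b` and `q < k * a / b`. -/
lemma gaps_eq_image (a b : ℕ) (hb : 0 < b) (hab : Nat.Coprime a b) :
    gaps a b = (((range b).sigma fun k => range (k * a / b)).image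
      fun p : (_ : ℕ) × ℕ => p.1 * a % b + p.2 * b : Finset ℕ) := by
  ext n
  rw [mem_gaps_iff a b hb hab]
  simp only [coe_image, Set.mem_image, mem_coe, mem_sigma, mem_range, Sigma.exists]
  constructor
  · rintro ⟨k, hk, hkn, hlt⟩
    exact ⟨k, n / b, ⟨hk, hlt⟩, by rw [hkn, Nat.mod_add_div']⟩
  · rintro ⟨k, q, ⟨hk, hq⟩, rfl⟩
    refine ⟨k, hk, by simp, ?_⟩
    rwa [Nat.add_mul_div_right _ _ hb, Nat.div_eq_of_lt (Nat.mod_lt _ hb), zero_add]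

lemma gaps_finite (a b : ℕ) (hb : 0 < b) (hab : Nat.Coprime a b) : (gaps a b).Finite := by
  rw [gaps_eq_image a b hb hab]
  exact Finset.finite_toSet _

open Finset in
lemma finsum_mem_gaps (a b : ℕ) (hb : 0 < b) (hab : Nat.Coprime a b) (f : ℕ → ℝ) :
    ∑ᶠ n ∈ gaps a b, f n
      = ∑ k ∈ range b, ∑ q ∈ range (k * a / b), f (k * a % b + q * b) := by
  rw [gaps_eq_image a b hb hab, finsum_mem_coe_finset, sum_image, sum_sigma]
  rintro ⟨k, q⟩ hk ⟨l, r⟩ hl heq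
  simp only [coe_sigma, Set.mem_sigma_iff, mem_coe, mem_range] at hk hl heq
  have hmod : k * a % b = l * a % b := by simpa using congrArg (· % b) heq
  obtain rfl : k = l :=
    injOn_mul_mod a b hab (by simpa using hk.1) (by simpa using hl.1) hmod
  obtain rfl : q = r := Nat.eq_of_mul_eq_mul_right hb (Nat.add_left_cancel heq)
  rfl

lemma apply_add_mul_div (b : ℕ) (hb : 0 < b) (h : ℝ → ℝ) (hper : ∀ x : ℝ, h (x + 1) = h x)
    (r q : ℕ) : h (((r + q * b : ℕ) : ℝ) / b) = h (r / b) := by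
  have hb' : (b : ℝ) ≠ 0 := by positivity
  have hp : Function.Periodic h 1 := hper
  have hx : ((r + q * b : ℕ) : ℝ) / b = r / b + q * 1 := by
    push_cast
    field_simp
  rw [hx, hp.nat_mul q]

open Finset in
lemma sum_mul_div_eq_add_finsum_gaps (a b : ℕ) (hb : 0 < b) (hab : Nat.Coprime a b)
    (h : ℝ → ℝ) (hper : ∀ x : ℝ, h (x + 1) = h x) :
    ∑ k ∈ range b, (k * a / b : ℝ) * h (k * a / b)
      = ∑ k ∈ range b, (k / b : ℝ) * h (k / b) + ∑ᶠ n ∈ gaps a b, h (n / b) := by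
  have hb' : (b : ℝ) ≠ 0 := by positivity
  have hperm : ∑ k ∈ range b, (k / b : ℝ) * h (k / b)
      = ∑ k ∈ range b, (((k * a % b : ℕ) : ℝ) / b) * h (((k * a % b : ℕ) : ℝ) / b) :=
    (sum_nbij (fun k => k * a % b) (fun k _ => mem_range.mpr (Nat.mod_lt _ hb))
      (injOn_mul_mod a b hab) (surjOn_mul_mod a b hb hab) fun _ _ => rfl).symm
  rw [finsum_mem_gaps a b hb hab, hperm, ← sum_add_distrib]
  refine sum_congr rfl fun k _ => ?_
  simp only [apply_add_mul_div b hb h hper, sum_const, card_range, nsmul_eq_mul]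
  have hdiv : (k * a : ℝ) = ((k * a % b + k * a / b * b : ℕ) : ℝ) := by
    rw [Nat.mod_add_div']
    push_cast
    rfl
  rw [hdiv, apply_add_mul_div b hb h hper]
  push_cast
  field_simp

theorem stmt_12 (a b : ℕ) (ha : 0 < a) (hb : 0 < b) (hab : Nat.Coprime a b)
    (h : ℝ → ℝ) (hper : ∀ x : ℝ, h (x + 1) = h x) (lam mu : ℝ) :
    lam * (∑ k ∈ Finset.range b, (k * a / b : ℝ) * h (k * a / b))
      + mu * (∑ k ∈ Finset.range a, (k * b / a : ℝ) * h (k * b / a))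
      = lam * (∑ k ∈ Finset.range b, (k / b : ℝ) * h (k / b))
        + mu * (∑ k ∈ Finset.range a, (k / a : ℝ) * h (k / a))
        + ∑ᶠ k ∈ gaps a b, (lam * h (k / b) + mu * h (k / a)) := by
  have hcomm : gaps a b = gaps b a := by
    rw [gaps, gaps, numSgp_comm]
  have hA := sum_mul_div_eq_add_finsum_gaps a b hb hab h hper
  have hB := sum_mul_div_eq_add_finsum_gaps b a ha hab.symm h hper
  rw [← hcomm] at hB
  have hfin := gaps_finite a b hb hab
  rw [hA, hB, finsum_mem_add_distrib hfin, mul_add, mul_add,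
    mul_finsum_mem, mul_finsum_mem]
  ring
end
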